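/- Let X = {x₁, …, xₙ} ⊂ ℝ^d be a dataset of n points with second moment matrix Σ = (1/n)∑ᵢ xᵢxᵢᵀ. Fix α > 0, β ∈ (0, 1/2], and an integer m′ ≥ 1. Suppose that when indices i₁, …, i_{m′} are drawn i.i.d. uniformly from {1, …, n} and Σ̂ = (1/m′)∑_{j=1}^{m′} x_{i_j} x_{i_j}ᵀ, then with probability at least 1 − β one has (1−α)·Σ ⪯ Σ̂ ⪯ (1+α)·Σ. Define P_tail(m′) = {x ∈ X : ∃ u ∈ ℝ^d, ⟨x,u⟩² > m′(1+α)·(1/n)∑ᵢ⟨xᵢ,u⟩²}. Then the fraction of points of X lying in P_tail(m′) is at most (β + β²)/m′, i.e., |P_tail(m′)| ≤ n·(β + β²)/m′. -/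

import Mathlib

open Matrix

/-- The Loewner order on real symmetric matrices: `loewnerLE A B` means `A ⪯ B`,
i.e. `B - A` is positive semidefinite. -/
def loewnerLE {d : ℕ} (A B : Matrix (Fin d) (Fin d) ℝ) : Prop :=
  (B - A).PosSemidef

theorem quad_vecMulVec_aux {d : ℕ} (v u : Fin d → ℝ) :
    u ⬝ᵥ (vecMulVec v v *ᵥ u) = (v ⬝ᵥ u) ^ 2 := by
  rw [vecMulVec_mulVec]
  simp [dotProduct_comm u v, sq]

theorem quad_sum_aux {d : ℕ} {ι : Type*} [Fintype ι] (c : ℝ) (v : ι → Fin d → ℝ)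
    (u : Fin d → ℝ) :
    u ⬝ᵥ ((c • ∑ i, vecMulVec (v i) (v i)) *ᵥ u) = c * ∑ i, (v i ⬝ᵥ u) ^ 2 := by
  rw [smul_mulVec, dotProduct_smul, sum_mulVec, dotProduct_sum]
  simp [quad_vecMulVec_aux]

theorem exp_bound_aux {β : ℝ} (hβ0 : 0 < β) (hβ : β ≤ 1 / 2) :
    Real.exp (-(β + β ^ 2)) ≤ 1 - β := by
  have h := Real.quadratic_le_exp_of_nonneg (x := β + β ^ 2) (by positivity)
  rw [Real.exp_neg]
  apply inv_le_of_inv_le₀ (by linarith)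
  refine le_trans ?_ h
  rw [inv_le_iff_one_le_mul₀ (by linarith)]
  have h1 : 0 ≤ 1 - β - β ^ 2 - β ^ 3 := by
    have h2 : β ^ 2 ≤ 1 / 4 := by nlinarith
    have h3 : β ^ 3 ≤ 1 / 8 := by nlinarith
    linarith
  have h4 : 0 ≤ β ^ 2 * (1 - β - β ^ 2 - β ^ 3) := by positivity
  nlinarith

theorem stmt2 {d n : ℕ} (hn : 0 < n) (x : Fin n → Fin d → ℝ)
    {α β : ℝ} (hα : 0 < α) (hβ0 : 0 < β) (hβ : β ≤ 1 / 2)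
    (m' : ℕ) (hm' : 1 ≤ m')
    (S : Matrix (Fin d) (Fin d) ℝ)
    (hS : S = (n : ℝ)⁻¹ • ∑ i, vecMulVec (x i) (x i))
    -- subsamplability at level `m'`: drawing `m'` indices i.i.d. uniformly from `Fin n`,
    -- with probability at least `1 - β` the empirical second moment matrix
    -- `Σ̂ = (1/m') ∑ⱼ x_{iⱼ} x_{iⱼ}ᵀ` satisfies `(1-α)·Σ ⪯ Σ̂ ⪯ (1+α)·Σ`
    (hsub : (1 - β) * (n : ℝ) ^ m' ≤
      Nat.card {σ : Fin m' → Fin n //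
        loewnerLE ((1 - α) • S) ((m' : ℝ)⁻¹ • ∑ j, vecMulVec (x (σ j)) (x (σ j))) ∧
        loewnerLE ((m' : ℝ)⁻¹ • ∑ j, vecMulVec (x (σ j)) (x (σ j))) ((1 + α) • S)}) :
    -- then the number of points in `P_tail(m')` is at most `n·(β + β²)/m'`
    (Nat.card {i : Fin n //
        ∃ u : Fin d → ℝ,
          (m' : ℝ) * (1 + α) * ((n : ℝ)⁻¹ * ∑ k, (x k ⬝ᵥ u) ^ 2) < (x i ⬝ᵥ u) ^ 2} : ℝ)
      ≤ n * (β + β ^ 2) / m' := by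
  classical
  set T : Fin n → Prop := fun i => ∃ u : Fin d → ℝ,
          (m' : ℝ) * (1 + α) * ((n : ℝ)⁻¹ * ∑ k, (x k ⬝ᵥ u) ^ 2) < (x i ⬝ᵥ u) ^ 2 with hT
  have hm : (0 : ℝ) < m' := by exact_mod_cast hm'
  have hnR : (0 : ℝ) < n := by exact_mod_cast hn
  have key : ∀ σ : Fin m' → Fin n,
      loewnerLE ((m' : ℝ)⁻¹ • ∑ j, vecMulVec (x (σ j)) (x (σ j))) ((1 + α) • S) →
      ∀ j, ¬ T (σ j) := by
    rintro σ h j ⟨u, hu⟩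
    have h0 := h.dotProduct_mulVec_nonneg u
    rw [star_trivial, sub_mulVec, dotProduct_sub, smul_mulVec (1 + α), dotProduct_smul, hS,
      quad_sum_aux, quad_sum_aux (m' : ℝ)⁻¹ (fun j => x (σ j)), smul_eq_mul] at h0
    have h1 : (x (σ j) ⬝ᵥ u) ^ 2 ≤ ∑ j, (x (σ j) ⬝ᵥ u) ^ 2 :=
      Finset.single_le_sum (f := fun j => (x (σ j) ⬝ᵥ u) ^ 2)
        (fun i _ => sq_nonneg _) (Finset.mem_univ j)
    have h2 := mul_nonneg hm.le h0
    rw [mul_sub, mul_inv_cancel_left₀ hm.ne'] at h2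
    linarith
  have hcard : Nat.card {σ : Fin m' → Fin n //
        loewnerLE ((1 - α) • S) ((m' : ℝ)⁻¹ • ∑ j, vecMulVec (x (σ j)) (x (σ j))) ∧
        loewnerLE ((m' : ℝ)⁻¹ • ∑ j, vecMulVec (x (σ j)) (x (σ j))) ((1 + α) • S)}
      ≤ Nat.card (Fin m' → {i : Fin n // ¬ T i}) := by
    refine Nat.card_le_card_of_injective
      (fun σ j => ⟨σ.1 j, key σ.1 σ.2.2 j⟩) ?_
    intro σ τ h
    apply Subtype.ext
    funext j
    exact congrArg Subtype.val (congrFun h j)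
  have hadd : (Nat.card {i : Fin n // T i} : ℝ) + Nat.card {i : Fin n // ¬ T i} = n := by
    have := Fintype.card_subtype_compl T
    have h2 := Fintype.card_subtype_le T
    simp only [Nat.card_eq_fintype_card]
    rw [Fintype.card_fin] at *
    exact_mod_cast (by omega : Fintype.card {i : Fin n // T i} + Fintype.card {i : Fin n // ¬ T i} = n)
  rw [Nat.card_fun, Nat.card_fin] at hcard
  have hcard2 := hsub.trans (Nat.cast_le (α := ℝ).2 hcard)
  push_cast at hcard2
  change (Nat.card {i : Fin n // T i} : ℝ) ≤ _
  set k : ℝ := (Nat.card {i : Fin n // T i} : ℝ)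
  set l : ℝ := (Nat.card {i : Fin n // ¬ T i} : ℝ) with hl
  have hl0 : 0 ≤ l := Nat.cast_nonneg _
  have h1 : l ≤ n * Real.exp (-(k / n)) := by
    have := Real.add_one_le_exp (-(k / n))
    calc l = n * (-(k / n) + 1) := by field_simp; linarith
      _ ≤ _ := by gcongr
  have h2 : l ^ m' ≤ n ^ m' * Real.exp (-(m' * (k / n))) := by
    calc l ^ m' ≤ (n * Real.exp (-(k / n))) ^ m' := by gcongr
      _ = _ := by rw [mul_pow, ← Real.exp_nat_mul, mul_neg]
  have h3 : 1 - β ≤ Real.exp (-(m' * (k / n))) := by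
    have : (n : ℝ) ^ m' * (1 - β) ≤ n ^ m' * Real.exp (-(m' * (k / n))) := by linarith
    exact le_of_mul_le_mul_left this (by positivity)
  have h4 := Real.exp_le_exp.1 ((exp_bound_aux hβ0 hβ).trans h3)
  have h5 : m' * (k / n) ≤ β + β ^ 2 := by linarith
  rw [le_div_iff₀ hm]
  calc k * m' = n * (m' * (k / n)) := by field_simp
    _ ≤ _ := by gcongr
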